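/- For every w ∈ A0_xy and every w' ∈ A−_xy: (F0·F−)_{w,x} = (F−·F0)_{w,x} = ((F0)²)_{w',x} = 0, ((F−)²)_{w,x} = q^{i+1}·[k−i], and (F0·F−)_{w',x} = (F−·F0)_{w',x} = (q−1)·[i]. -/

import Mathlib

open scoped Classical

noncomputable section

variable {F V : Type} [Field F] [AddCommGroup V] [Module F V]

/-- `v` covers `u` in the projective geometry `P`. -/
def Covers (u v : Submodule F V) : Prop :=
  u ≤ v ∧ Module.finrank F ↥v = Module.finrank F ↥u + 1

/-- `v` slash-covers `u` (relative to the fixed subspace `y`). -/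
def SlashCovers (y u v : Submodule F V) : Prop :=
  Covers u v ∧ Module.finrank F ↥(v ⊓ y) = Module.finrank F ↥(u ⊓ y) + 1

/-- `v` backslash-covers `u` (relative to the fixed subspace `y`). -/
def BackslashCovers (y u v : Submodule F V) : Prop :=
  Covers u v ∧ Module.finrank F ↥(v ⊓ y) = Module.finrank F ↥(u ⊓ y)

/-- `q` raised to a real exponent, as a complex number. -/
def qpow (q : ℕ) (e : ℝ) : ℂ := (((q : ℝ) ^ e : ℝ) : ℂ)

/-- The Gaussian bracket `[m] = (q^m - 1)/(q - 1)` as a rational number. -/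
def gaussQ (q m : ℕ) : ℚ := ((q : ℚ) ^ m - 1) / ((q : ℚ) - 1)

/-- The Gaussian bracket `[m] = (q^m - 1)/(q - 1)` as a complex number. -/
def gaussC (q m : ℕ) : ℂ := ((q : ℂ) ^ m - 1) / ((q : ℂ) - 1)

/-- The diagonal matrix `K1`; the `(u,u)` entry is `q^(k/2 - i)` for `u ∈ P_{i,j}`. -/
def matK1 (q k : ℕ) (y : Submodule F V) : Matrix (Submodule F V) (Submodule F V) ℂ :=
  Matrix.diagonal fun u => qpow q ((k : ℝ) / 2 - (Module.finrank F ↥(u ⊓ y) : ℝ))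

/-- The diagonal matrix `K2`; the `(u,u)` entry is `q^(j - (n-k)/2)` for `u ∈ P_{i,j}`. -/
def matK2 (q n k : ℕ) (y : Submodule F V) : Matrix (Submodule F V) (Submodule F V) ℂ :=
  Matrix.diagonal fun u =>
    qpow q (((Module.finrank F ↥u : ℝ) - (Module.finrank F ↥(u ⊓ y) : ℝ))
      - ((n : ℝ) - (k : ℝ)) / 2)

/-- The 0-1 matrix `L1`; the `(u,v)` entry is `1` iff `v` slash-covers `u`. -/
def matL1 (y : Submodule F V) : Matrix (Submodule F V) (Submodule F V) ℂ :=
  Matrix.of fun u v => if SlashCovers y u v then (1 : ℂ) else 0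

/-- The 0-1 matrix `L2`; the `(u,v)` entry is `1` iff `v` backslash-covers `u`. -/
def matL2 (y : Submodule F V) : Matrix (Submodule F V) (Submodule F V) ℂ :=
  Matrix.of fun u v => if BackslashCovers y u v then (1 : ℂ) else 0

/-- `R1 = L1ᵀ`. -/
def matR1 (y : Submodule F V) : Matrix (Submodule F V) (Submodule F V) ℂ := Matrix.transpose (matL1 y)

/-- `R2 = L2ᵀ`. -/
def matR2 (y : Submodule F V) : Matrix (Submodule F V) (Submodule F V) ℂ := Matrix.transpose (matL2 y)

/-- `R = L1 · R2`. -/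
def matR [Fintype (Submodule F V)] (y : Submodule F V) :
    Matrix (Submodule F V) (Submodule F V) ℂ := matL1 y * matR2 y

/-- `L = R1 · L2`. -/
def matL [Fintype (Submodule F V)] (y : Submodule F V) :
    Matrix (Submodule F V) (Submodule F V) ℂ := matR1 y * matL2 y

/-- The 0-1 matrix `F0`. -/
def matF0 (y : Submodule F V) : Matrix (Submodule F V) (Submodule F V) ℂ :=
  Matrix.of fun u v =>
    if SlashCovers y u (u ⊔ v) ∧ SlashCovers y v (u ⊔ v) ∧
        BackslashCovers y (u ⊓ v) u ∧ BackslashCovers y (u ⊓ v) v then (1 : ℂ) else 0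

/-- The 0-1 matrix `F+`. -/
def matFp (y : Submodule F V) : Matrix (Submodule F V) (Submodule F V) ℂ :=
  Matrix.of fun u v =>
    if BackslashCovers y u (u ⊔ v) ∧ BackslashCovers y v (u ⊔ v) then (1 : ℂ) else 0

/-- The 0-1 matrix `F-`. -/
def matFm (y : Submodule F V) : Matrix (Submodule F V) (Submodule F V) ℂ :=
  Matrix.of fun u v =>
    if SlashCovers y (u ⊓ v) u ∧ SlashCovers y (u ⊓ v) v then (1 : ℂ) else 0

/-- The vertex set `X` of the Grassmann graph: `k`-dimensional subspaces of `V`. -/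
abbrev GrassVertex (F V : Type) [Field F] [AddCommGroup V] [Module F V] (k : ℕ) :=
  {z : Submodule F V // Module.finrank F ↥z = k}

/-- The Grassmann graph `J_q(n,k)`: vertices are adjacent iff their intersection
has dimension `k - 1`. -/
def Grass (F V : Type) [Field F] [AddCommGroup V] [Module F V] (k : ℕ) :
    SimpleGraph (GrassVertex F V k) :=
  SimpleGraph.fromRel fun a b => Module.finrank F ↥(a.1 ⊓ b.1) = k - 1

/-- `B_xy = {z ∈ Γ(x) : ∂(z,y) = ∂(x,y) + 1}`. -/
def Bset {k : ℕ} (x y : GrassVertex F V k) : Set (GrassVertex F V k) :=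
  {z | (Grass F V k).Adj x z ∧ (Grass F V k).dist z y = (Grass F V k).dist x y + 1}

/-- `C_xy = {z ∈ Γ(x) : ∂(z,y) = ∂(x,y) - 1}`. -/
def Cset {k : ℕ} (x y : GrassVertex F V k) : Set (GrassVertex F V k) :=
  {z | (Grass F V k).Adj x z ∧ (Grass F V k).dist z y = (Grass F V k).dist x y - 1}

/-- `A_xy = {z ∈ Γ(x) : ∂(z,y) = ∂(x,y)}`. -/
def Aset {k : ℕ} (x y : GrassVertex F V k) : Set (GrassVertex F V k) :=
  {z | (Grass F V k).Adj x z ∧ (Grass F V k).dist z y = (Grass F V k).dist x y}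

/-- `A0_xy`. -/
def A0set {k : ℕ} (x y : GrassVertex F V k) : Set (GrassVertex F V k) :=
  {z | (Grass F V k).Adj x z ∧
    SlashCovers y.1 z.1 (z.1 ⊔ x.1) ∧ SlashCovers y.1 x.1 (z.1 ⊔ x.1) ∧
    BackslashCovers y.1 (z.1 ⊓ x.1) z.1 ∧ BackslashCovers y.1 (z.1 ⊓ x.1) x.1}

/-- `A+_xy`. -/
def Apset {k : ℕ} (x y : GrassVertex F V k) : Set (GrassVertex F V k) :=
  {z | (Grass F V k).Adj x z ∧
    BackslashCovers y.1 z.1 (z.1 ⊔ x.1) ∧ BackslashCovers y.1 x.1 (z.1 ⊔ x.1)}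

/-- `A-_xy`. -/
def Amset {k : ℕ} (x y : GrassVertex F V k) : Set (GrassVertex F V k) :=
  {z | (Grass F V k).Adj x z ∧
    SlashCovers y.1 (z.1 ⊓ x.1) z.1 ∧ SlashCovers y.1 (z.1 ⊓ x.1) x.1}

/-- The edge `wz` has type `0`. -/
def EdgeType0 {k : ℕ} (y w z : GrassVertex F V k) : Prop :=
  SlashCovers y.1 w.1 (w.1 ⊔ z.1) ∧ SlashCovers y.1 z.1 (w.1 ⊔ z.1) ∧
  BackslashCovers y.1 (w.1 ⊓ z.1) w.1 ∧ BackslashCovers y.1 (w.1 ⊓ z.1) z.1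

/-- The edge `wz` has type `+`. -/
def EdgeTypeP {k : ℕ} (y w z : GrassVertex F V k) : Prop :=
  BackslashCovers y.1 w.1 (w.1 ⊔ z.1) ∧ BackslashCovers y.1 z.1 (w.1 ⊔ z.1)

/-- The edge `wz` has type `-`. -/
def EdgeTypeM {k : ℕ} (y w z : GrassVertex F V k) : Prop :=
  SlashCovers y.1 (w.1 ⊓ z.1) w.1 ∧ SlashCovers y.1 (w.1 ⊓ z.1) z.1

open Module Submodule

/-- The subspaces of codimension one in `W` that contain `S`. -/
def hyperplanesBetween (S W : Submodule F V) : Set (Submodule F V) :=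
  {z | S ≤ z ∧ z ≤ W ∧ finrank F z + 1 = finrank F W}

section Counting

variable [FiniteDimensional F V]

theorem card_hyperplanes [Finite F] {m : ℕ} (hm : finrank F V = m) :
    Nat.card {H : Submodule F V // finrank F H + 1 = finrank F V} =
      ∑ j ∈ Finset.range m, Nat.card F ^ j := by
  have hdual : finrank F (Dual F V) = m := by rw [Subspace.dual_finrank_eq, hm]
  rw [← Projectivization.card_of_finrank F (Dual F V) hdual]
  refine Nat.card_congr (Equiv.trans ?_ (Projectivization.equivSubmodule F (Dual F V)).symm)
  refine Equiv.subtypeEquiv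
    (Subspace.orderIsoFiniteDimensional.toEquiv.trans OrderDual.ofDual) fun H => ?_
  have h := Subspace.finrank_add_finrank_dualAnnihilator_eq H
  change _ ↔ finrank F H.dualAnnihilator = 1
  omega

theorem finrank_map_mkQ_add (S T : Submodule F V) (h : S ≤ T) :
    finrank F (T.map S.mkQ) + finrank F V = finrank F T + finrank F (V ⧸ S) := by
  have h1 := (quotientQuotientEquivQuotient S T h).finrank_eq
  have h2 := (T.map S.mkQ).finrank_quotient_add_finrank
  have h3 := T.finrank_quotient_add_finrank
  omega

theorem ncard_hyperplanesBetween [Finite F] {S W : Submodule F V} (hSW : S ≤ W) {m : ℕ}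
    (hm : finrank F W = finrank F S + m) :
    (hyperplanesBetween S W).ncard = ∑ j ∈ Finset.range m, Nat.card F ^ j := by
  set S' : Submodule F W := S.comap W.subtype with hS'
  have hfS' : finrank F S' = finrank F S := by
    rw [← finrank_map_subtype_eq, hS', map_comap_subtype, inf_eq_right.2 hSW]
  have hq := S'.finrank_quotient_add_finrank
  rw [← card_hyperplanes (F := F) (V := W ⧸ S') (m := m) (by omega), ← Nat.card_coe_set_eq]
  symm
  have hcomap : ∀ H : Submodule F (W ⧸ S'),
      finrank F H + finrank F W =
        finrank F ((H.comap S'.mkQ).map W.subtype) + finrank F (W ⧸ S') := by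
    intro H
    rw [finrank_map_subtype_eq, ← finrank_map_mkQ_add S' _ (le_comap_mkQ S' H),
      map_comap_eq_of_surjective S'.mkQ_surjective]
  refine Nat.card_eq_of_bijective
    (fun H => ⟨(H.1.comap S'.mkQ).map W.subtype, ?_, map_subtype_le W _, ?_⟩) ⟨?_, ?_⟩
  · rw [← inf_eq_right.2 hSW, ← map_comap_subtype]
    exact map_mono (le_comap_mkQ S' H.1)
  · have h1 := hcomap H.1
    have h2 := H.2
    omega
  · intro H₁ H₂ h
    exact Subtype.ext (comap_injective_of_surjective S'.mkQ_surjective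
      (map_injective_of_injective W.injective_subtype (congrArg Subtype.val h)))
  · rintro ⟨z, hSz, hzW, hz⟩
    have hle : S' ≤ z.comap W.subtype := comap_mono hSz
    have heq : (((z.comap W.subtype).map S'.mkQ).comap S'.mkQ).map W.subtype = z := by
      rw [comap_map_mkQ, sup_eq_right.2 hle, map_comap_subtype, inf_eq_right.2 hzW]
    refine ⟨⟨(z.comap W.subtype).map S'.mkQ, ?_⟩, Subtype.ext heq⟩
    have h1 := hcomap ((z.comap W.subtype).map S'.mkQ)
    rw [heq] at h1
    omega

end Counting

section Dimension

variable [FiniteDimensional F V]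

theorem finrank_inf_add_one_of_hyperplane {z T W : Submodule F V} (hz : z ≤ W)
    (hdim : finrank F z + 1 = finrank F W) (hT : T ≤ W) (hTz : ¬ T ≤ z) :
    finrank F ↥(z ⊓ T) + 1 = finrank F T := by
  have h1 := finrank_lt_finrank_of_lt (left_lt_sup.2 hTz)
  have h2 := finrank_mono (sup_le hz hT)
  have h3 := finrank_sup_add_finrank_inf_eq z T
  omega

theorem le_sup_of_inf_ne {u v z : Submodule F V} (hzu : finrank F z = finrank F ↥(z ⊓ u) + 1)
    (hzv : finrank F z = finrank F ↥(z ⊓ v) + 1) (hne : z ⊓ u ≠ z ⊓ v) : z ≤ u ⊔ v := by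
  have hlt : z ⊓ u < (z ⊓ u) ⊔ (z ⊓ v) := by
    refine left_lt_sup.2 fun hle => hne (eq_of_le_of_finrank_eq hle (by omega)).symm
  have h1 := finrank_lt_finrank_of_lt hlt
  have hle : (z ⊓ u) ⊔ (z ⊓ v) ≤ z := sup_le inf_le_left inf_le_left
  rw [← eq_of_le_of_finrank_le hle (by omega)]
  exact sup_le_sup inf_le_right inf_le_right

theorem finrank_inf_le_add_one {x z y : Submodule F V}
    (h : finrank F z ≤ finrank F ↥(x ⊓ z) + 1) :
    finrank F ↥(z ⊓ y) ≤ finrank F ↥(x ⊓ y) + 1 := by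
  have h1 := finrank_sup_add_finrank_inf_eq (x ⊓ z) (z ⊓ y)
  have h2 := finrank_mono (sup_le inf_le_right inf_le_left : (x ⊓ z) ⊔ (z ⊓ y) ≤ z)
  have h3 := finrank_mono
    (le_inf (inf_le_left.trans inf_le_left) (inf_le_right.trans inf_le_right) :
      (x ⊓ z) ⊓ (z ⊓ y) ≤ x ⊓ y)
  omega

end Dimension

section Distance

variable {k : ℕ}

theorem grass_adj_iff {a b : GrassVertex F V k} :
    (Grass F V k).Adj a b ↔ a ≠ b ∧ finrank F ↥(a.1 ⊓ b.1) = k - 1 := by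
  rw [Grass, SimpleGraph.fromRel_adj, inf_comm b.1 a.1, or_self]

variable [FiniteDimensional F V]

theorem le_finrank_inf_add_length {x y : GrassVertex F V k} (p : (Grass F V k).Walk x y) :
    k ≤ finrank F ↥(x.1 ⊓ y.1) + p.length := by
  induction p with
  | @nil u => rw [inf_idem, u.2]; exact Nat.le_add_right _ _
  | @cons u v w h p ih =>
    have h1 := (grass_adj_iff.1 h).2
    have h2 : finrank F ↥(v.1 ⊓ w.1) ≤ finrank F ↥(u.1 ⊓ w.1) + 1 :=
      finrank_inf_le_add_one (by rw [v.2]; omega)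
    rw [SimpleGraph.Walk.length_cons]
    omega

theorem exists_adj_finrank_inf [Finite F] {x y : GrassVertex F V k}
    (h : finrank F ↥(x.1 ⊓ y.1) < k) :
    ∃ z, (Grass F V k).Adj x z ∧ finrank F ↥(z.1 ⊓ y.1) = finrank F ↥(x.1 ⊓ y.1) + 1 := by
  have hx := x.2
  obtain ⟨m, hm⟩ := Nat.exists_eq_add_of_lt h
  have hcard := ncard_hyperplanesBetween (F := F) (inf_le_left : x.1 ⊓ y.1 ≤ x.1) (m := m + 1)
    (by omega)
  obtain ⟨H, hH, hHx, hHd⟩ : (hyperplanesBetween (x.1 ⊓ y.1) x.1).Nonempty := by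
    refine Set.nonempty_of_ncard_ne_zero ?_
    rw [hcard, Finset.sum_range_succ']
    simp
  have hyx : ¬ y.1 ≤ x.1 := fun hle => by
    rw [inf_eq_right.2 hle, y.2] at h
    exact lt_irrefl _ h
  obtain ⟨v, hvy, hvx⟩ := SetLike.not_le_iff_exists.1 hyx
  have hvH : v ∉ H := fun hv => hvx (hHx hv)
  have hzd : finrank F ↥(H ⊔ span F {v}) = k := by
    have h1 := finrank_lt_finrank_of_lt
      (left_lt_sup.2 (by simpa using hvH) : H < H ⊔ span F {v})
    have h2 := finrank_add_le_finrank_add_finrank H (span F {v})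
    have h3 := finrank_span_singleton (K := F) (v := v) fun h0 => hvx (h0 ▸ zero_mem _)
    omega
  have hvz : v ∈ H ⊔ span F {v} := mem_sup_right (mem_span_singleton_self v)
  have hne : x.1 ≠ H ⊔ span F {v} := fun he => hvx (he ▸ hvz)
  have hxz : finrank F ↥(x.1 ⊓ (H ⊔ span F {v})) = k - 1 := by
    have h1 := finrank_mono (le_inf hHx le_sup_left : H ≤ x.1 ⊓ (H ⊔ span F {v}))
    have h2 : finrank F ↥(x.1 ⊓ (H ⊔ span F {v})) < finrank F x.1 :=
      finrank_lt_finrank_of_lt (inf_lt_left.2 fun hle =>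
        hne (eq_of_le_of_finrank_eq hle (by omega)))
    omega
  refine ⟨⟨H ⊔ span F {v}, hzd⟩, grass_adj_iff.2 ⟨fun he => hne (congrArg Subtype.val he), hxz⟩,
    le_antisymm (finrank_inf_le_add_one (by rw [hxz, hzd]; omega)) ?_⟩
  refine finrank_lt_finrank_of_lt (lt_of_le_of_ne
    (le_inf (hH.trans le_sup_left) inf_le_right) fun he => hvx ?_)
  have hv : v ∈ (H ⊔ span F {v}) ⊓ y.1 := ⟨hvz, hvy⟩
  rw [← he] at hv
  exact hv.1

theorem exists_walk_length_eq [Finite F] {m : ℕ} {x y : GrassVertex F V k}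
    (h : finrank F ↥(x.1 ⊓ y.1) + m = k) : ∃ p : (Grass F V k).Walk x y, p.length = m := by
  induction m generalizing x with
  | zero =>
    have h1 : x.1 ⊓ y.1 = x.1 := eq_of_le_of_finrank_eq inf_le_left (by rw [x.2]; omega)
    obtain rfl : x = y := Subtype.ext
      (eq_of_le_of_finrank_eq (inf_eq_left.1 h1) (by rw [x.2, y.2]))
    exact ⟨.nil, rfl⟩
  | succ m ih =>
    obtain ⟨z, hxz, hz⟩ := exists_adj_finrank_inf (x := x) (y := y) (by omega)
    obtain ⟨p, hp⟩ := ih (x := z) (by omega)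
    exact ⟨.cons hxz p, by rw [SimpleGraph.Walk.length_cons, hp]⟩

theorem finrank_inf_add_dist [Finite F] (x y : GrassVertex F V k) :
    finrank F ↥(x.1 ⊓ y.1) + (Grass F V k).dist x y = k := by
  have hle : finrank F ↥(x.1 ⊓ y.1) ≤ k := (finrank_mono inf_le_left).trans x.2.le
  obtain ⟨p, hp⟩ := exists_walk_length_eq (m := k - finrank F ↥(x.1 ⊓ y.1)) (x := x) (y := y)
    (by omega)
  obtain ⟨p', hp'⟩ := (SimpleGraph.Walk.reachable p).exists_walk_length_eq_dist
  have h1 := le_finrank_inf_add_length p'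
  have h2 := SimpleGraph.dist_le p
  omega

end Distance

section Edges

variable {y w x z : Submodule F V}

theorem matF0_comm (y u v : Submodule F V) : matF0 y u v = matF0 y v u := by
  simp only [matF0, Matrix.of_apply, sup_comm u v, inf_comm u v]
  congr 1
  exact propext (by tauto)

theorem matFm_comm (y u v : Submodule F V) : matFm y u v = matFm y v u := by
  simp only [matFm, Matrix.of_apply, inf_comm u v]
  congr 1
  exact propext (by tauto)

theorem matFm_mul_matF0_apply [Fintype (Submodule F V)] (y u v : Submodule F V) :
    (matFm y * matF0 y) u v = (matF0 y * matFm y) v u := by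
  simp only [Matrix.mul_apply]
  exact Finset.sum_congr rfl fun z _ => by rw [matF0_comm, matFm_comm, mul_comm]

theorem sum_ite_mul_ite_eq_ncard {α : Type*} [Fintype α] (P Q : α → Prop) [DecidablePred P]
    [DecidablePred Q] :
    ∑ z, (if P z then (1 : ℂ) else 0) * (if Q z then (1 : ℂ) else 0) =
      ({z | P z ∧ Q z}.ncard : ℂ) := by
  simp only [ite_zero_mul_ite_zero, mul_one]
  rw [Finset.sum_boole, ← Set.ncard_coe_finset, Finset.coe_filter_univ]

variable [FiniteDimensional F V]

theorem BackslashCovers.inf_eq (h : BackslashCovers y w x) : w ⊓ y = x ⊓ y :=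
  eq_of_le_of_finrank_eq (inf_le_inf_right y h.1.1) h.2.symm

theorem inf_eq_of_matF0_ne_zero (h : matF0 y w x ≠ 0) : w ⊓ y = x ⊓ y := by
  simp only [matF0, Matrix.of_apply, ne_eq, ite_eq_right_iff, Classical.not_imp] at h
  exact h.1.2.2.1.inf_eq.symm.trans h.1.2.2.2.inf_eq

theorem inf_ne_of_slashCovers (hw : SlashCovers y (w ⊓ x) w) : w ⊓ y ≠ x ⊓ y := by
  intro he
  have hle : w ⊓ y ≤ w ⊓ x ⊓ y :=
    le_inf (le_inf inf_le_left (he.le.trans inf_le_left)) inf_le_right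
  have h1 := finrank_mono hle
  have h2 := hw.2
  omega

theorem inf_ne_of_matFm_ne_zero (h : matFm y w x ≠ 0) : w ⊓ y ≠ x ⊓ y := by
  simp only [matFm, Matrix.of_apply, ne_eq, ite_eq_right_iff, Classical.not_imp] at h
  exact inf_ne_of_slashCovers h.1.1

theorem matF0_mul_matFm_apply_eq_zero [Fintype (Submodule F V)] (h : w ⊓ y = x ⊓ y) :
    (matF0 y * matFm y) w x = 0 := by
  rw [Matrix.mul_apply]
  refine Finset.sum_eq_zero fun z _ => ?_
  by_contra hne
  obtain ⟨h1, h2⟩ := mul_ne_zero_iff.1 hne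
  exact inf_ne_of_matFm_ne_zero h2 ((inf_eq_of_matF0_ne_zero h1).symm.trans h)

theorem matF0_mul_matF0_apply_eq_zero [Fintype (Submodule F V)] (h : w ⊓ y ≠ x ⊓ y) :
    (matF0 y * matF0 y) w x = 0 := by
  rw [Matrix.mul_apply]
  refine Finset.sum_eq_zero fun z _ => ?_
  by_contra hne
  obtain ⟨h1, h2⟩ := mul_ne_zero_iff.1 hne
  exact h ((inf_eq_of_matF0_ne_zero h1).trans (inf_eq_of_matF0_ne_zero h2))

theorem setOf_matFm_path_eq (hw : SlashCovers y w (w ⊔ x)) (hx : SlashCovers y x (w ⊔ x))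
    (hwx : BackslashCovers y (w ⊓ x) w) (hxw : BackslashCovers y (w ⊓ x) x) :
    {z | (SlashCovers y (w ⊓ z) w ∧ SlashCovers y (w ⊓ z) z) ∧
      (SlashCovers y (z ⊓ x) z ∧ SlashCovers y (z ⊓ x) x)} =
    hyperplanesBetween ⊥ (w ⊔ x) \ hyperplanesBetween (x ⊓ y) (w ⊔ x) := by
  have hA : w ⊓ y = x ⊓ y := hwx.inf_eq.symm.trans hxw.inf_eq
  have hAle : x ⊓ y ≤ w ⊓ x := le_inf (hA ▸ inf_le_left) inf_le_left
  have hAd : finrank F ↥(w ⊓ y) = finrank F ↥(x ⊓ y) := by rw [hA]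
  ext z
  constructor
  · rintro ⟨⟨h1, h2⟩, h3, h4⟩
    have hAz : ¬ x ⊓ y ≤ z := fun hle => by
      have hm := finrank_mono (le_inf (le_inf hle inf_le_left) inf_le_right :
        x ⊓ y ≤ z ⊓ x ⊓ y)
      have := h4.2
      omega
    have hd := h1.1.2
    have hd2 := h2.1.2
    have hd3 := h3.1.2
    have hd4 := hw.1.2
    have hd5 := hwx.1.2
    rw [inf_comm w z] at hd hd2
    have hne : z ⊓ w ≠ z ⊓ x := by
      intro he
      have hle : z ⊓ w ≤ w ⊓ x := le_inf inf_le_right (he.le.trans inf_le_right)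
      have := eq_of_le_of_finrank_eq hle (by omega)
      exact hAz (hAle.trans (this ▸ inf_le_left))
    exact ⟨⟨bot_le, le_sup_of_inf_ne hd2 hd3 hne, by omega⟩, fun h => hAz h.1⟩
  · rintro ⟨⟨-, hzW, hzd⟩, hn⟩
    have hAz : ¬ x ⊓ y ≤ z := fun h => hn ⟨h, hzW, hzd⟩
    have hd1 := hw.1.2
    have hd2 := hx.1.2
    have hd3 := hx.2
    have e1 := finrank_inf_add_one_of_hyperplane hzW hzd le_sup_left
      (fun h => hAz (hA ▸ inf_le_left.trans h))
    have e2 := finrank_inf_add_one_of_hyperplane hzW hzd le_sup_right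
      (fun h => hAz (inf_le_left.trans h))
    have e3 := finrank_inf_add_one_of_hyperplane hzW hzd
      (inf_le_left.trans le_sup_right : x ⊓ y ≤ w ⊔ x) hAz
    have e4 := finrank_inf_add_one_of_hyperplane hzW hzd
      (inf_le_left : (w ⊔ x) ⊓ y ≤ w ⊔ x)
      (fun h => hAz ((inf_le_inf_right y le_sup_right).trans h))
    rw [← inf_assoc, inf_eq_left.2 hzW] at e4
    have e5 : finrank F ↥(z ⊓ w ⊓ y) + 1 = finrank F ↥(x ⊓ y) := by rwa [inf_assoc, hA]
    rw [← inf_assoc] at e3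
    rw [Set.mem_ofPred_eq, inf_comm w z]
    refine ⟨⟨⟨⟨inf_le_right, ?_⟩, ?_⟩, ⟨inf_le_left, ?_⟩, ?_⟩,
      ⟨⟨inf_le_left, ?_⟩, ?_⟩, ⟨inf_le_right, ?_⟩, ?_⟩ <;> omega

theorem finrank_sup_inf_of_slashCovers (hw : SlashCovers y (w ⊓ x) w)
    (hx : SlashCovers y (w ⊓ x) x) :
    finrank F ↥((w ⊔ x) ⊓ y) = finrank F ↥(x ⊓ y) + 1 ∧
      finrank F ↥((w ⊓ y) ⊔ (x ⊓ y)) = finrank F ↥(x ⊓ y) + 1 := by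
  have h1 := finrank_sup_add_finrank_inf_eq w x
  have h2 := finrank_sup_add_finrank_inf_eq (w ⊓ y) (x ⊓ y)
  rw [← inf_inf_distrib_right] at h2
  have h3 := finrank_mono (sup_le (inf_le_inf_right y le_sup_left)
    (inf_le_inf_right y le_sup_right) : (w ⊓ y) ⊔ (x ⊓ y) ≤ (w ⊔ x) ⊓ y)
  have h4 := hw.1.2
  have h5 := hw.2
  have h6 := hx.2
  have h7 : finrank F ↥((w ⊔ x) ⊓ y) ≤ finrank F ↥(x ⊓ y) + 1 :=
    finrank_inf_le_add_one (by rw [inf_eq_left.2 le_sup_right]; omega)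
  omega

theorem setOf_matF0_matFm_path_eq (hw : SlashCovers y (w ⊓ x) w)
    (hx : SlashCovers y (w ⊓ x) x) :
    {z | (SlashCovers y w (w ⊔ z) ∧ SlashCovers y z (w ⊔ z) ∧
        BackslashCovers y (w ⊓ z) w ∧ BackslashCovers y (w ⊓ z) z) ∧
      (SlashCovers y (z ⊓ x) z ∧ SlashCovers y (z ⊓ x) x)} =
    (hyperplanesBetween (w ⊓ y) (w ⊔ x) \ hyperplanesBetween ((w ⊔ x) ⊓ y) (w ⊔ x)) \ {w} := by
  obtain ⟨hW, hY⟩ := finrank_sup_inf_of_slashCovers hw hx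
  have hd := finrank_sup_add_finrank_inf_eq w x
  have hd1 := hw.1.2
  have hd2 := hx.1.2
  have hd3 := hw.2
  have hd4 := hx.2
  have hwyx : ¬ w ⊓ y ≤ x := fun hle => by
    have := finrank_mono (le_inf (le_inf inf_le_left hle) inf_le_right : w ⊓ y ≤ w ⊓ x ⊓ y)
    omega
  ext z
  constructor
  · rintro ⟨⟨-, -, h1, h2⟩, h3, -⟩
    have e1 := h1.1.2
    have e2 := h2.1.2
    have e3 := h3.1.2
    have e4 := h1.2
    have e5 := h2.2
    have hwz : w ⊓ y ≤ w ⊓ z := h1.inf_eq ▸ inf_le_left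
    have hzW : z ≤ w ⊔ x := by
      refine le_sup_of_inf_ne (inf_comm w z ▸ e2) e3 fun he => hwyx ?_
      exact hwz.trans ((inf_comm w z).le.trans (he.le.trans inf_le_right))
    refine ⟨⟨⟨hwz.trans inf_le_right, hzW, by omega⟩, fun h => ?_⟩, ?_⟩
    · have := finrank_mono (le_inf h.1 inf_le_right : (w ⊔ x) ⊓ y ≤ z ⊓ y)
      omega
    · rintro rfl
      rw [inf_idem] at e1
      omega
  · rintro ⟨⟨⟨hwz, hzW, hzd⟩, hn⟩, hne⟩
    have hYz : ¬ (w ⊔ x) ⊓ y ≤ z := fun h => hn ⟨h, hzW, hzd⟩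
    have hxyz : ¬ x ⊓ y ≤ z := fun h => by
      have he := eq_of_le_of_finrank_eq
        (sup_le (inf_le_inf_right y le_sup_left) (inf_le_inf_right y le_sup_right) :
          (w ⊓ y) ⊔ (x ⊓ y) ≤ (w ⊔ x) ⊓ y) (by omega)
      exact hYz (he ▸ sup_le hwz h)
    have e1 := finrank_inf_add_one_of_hyperplane hzW hzd le_sup_left
      (fun h => hne (eq_of_le_of_finrank_eq h (by omega)).symm)
    have e2 := finrank_inf_add_one_of_hyperplane hzW hzd le_sup_right
      (fun h => hxyz (inf_le_left.trans h))
    have e3 := finrank_inf_add_one_of_hyperplane hzW hzd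
      (inf_le_left.trans le_sup_right : x ⊓ y ≤ w ⊔ x) hxyz
    have e4 := finrank_inf_add_one_of_hyperplane hzW hzd
      (inf_le_left : (w ⊔ x) ⊓ y ≤ w ⊔ x) hYz
    rw [← inf_assoc] at e3
    rw [← inf_assoc, inf_eq_left.2 hzW] at e4
    have e5 := finrank_sup_add_finrank_inf_eq w z
    rw [inf_comm z w] at e1
    have hsup : w ⊔ z = w ⊔ x := eq_of_le_of_finrank_eq (sup_le le_sup_left hzW) (by omega)
    have e6 : finrank F ↥(w ⊓ z ⊓ y) = finrank F ↥(w ⊓ y) := by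
      rw [inf_right_comm, inf_eq_left.2 hwz]
    rw [Set.mem_ofPred_eq, hsup]
    refine ⟨⟨⟨⟨le_sup_left, ?_⟩, ?_⟩, ⟨⟨hzW, ?_⟩, ?_⟩, ⟨⟨inf_le_left, ?_⟩, ?_⟩,
      ⟨inf_le_right, ?_⟩, ?_⟩, ⟨⟨inf_le_left, ?_⟩, ?_⟩, ⟨inf_le_right, ?_⟩, ?_⟩ <;> omega

theorem gaussC_eq_sum {q : ℕ} (hq : 1 < q) (m : ℕ) :
    gaussC q m = ∑ j ∈ Finset.range m, (q : ℂ) ^ j := by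
  rw [gaussC, geom_sum_eq (by exact_mod_cast hq.ne')]

theorem matFm_mul_matFm_apply [Finite F] [Fintype (Submodule F V)] {q i : ℕ}
    (hq : Nat.card F = q) (hi : finrank F x = finrank F ↥(x ⊓ y) + i)
    (hw : SlashCovers y w (w ⊔ x)) (hx : SlashCovers y x (w ⊔ x))
    (hwx : BackslashCovers y (w ⊓ x) w) (hxw : BackslashCovers y (w ⊓ x) x) :
    (matFm y * matFm y) w x = (q : ℂ) ^ (i + 1) * gaussC q (finrank F ↥(x ⊓ y)) := by
  have hq1 : 1 < q := hq ▸ Finite.one_lt_card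
  simp only [Matrix.mul_apply, matFm, Matrix.of_apply]
  rw [sum_ite_mul_ite_eq_ncard, setOf_matFm_path_eq hw hx hwx hxw]
  have hd := hx.1.2
  have hsub : hyperplanesBetween (x ⊓ y) (w ⊔ x) ⊆ hyperplanesBetween ⊥ (w ⊔ x) :=
    fun z hz => ⟨bot_le, hz.2⟩
  have h := Set.ncard_sdiff_add_ncard_of_subset hsub
  rw [ncard_hyperplanesBetween (inf_le_left.trans le_sup_right) (m := i + 1) (by omega),
    ncard_hyperplanesBetween bot_le (m := (i + 1) + finrank F ↥(x ⊓ y))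
      (by rw [finrank_bot]; omega), Finset.sum_range_add _ (i + 1), hq, add_comm, Nat.add_left_cancel_iff] at h
  rw [h, gaussC_eq_sum hq1, Finset.mul_sum]
  push_cast
  exact Finset.sum_congr rfl fun j _ => pow_add _ _ _

theorem matF0_mul_matFm_apply [Finite F] [Fintype (Submodule F V)] {q i : ℕ}
    (hq : Nat.card F = q) (hi : finrank F x = finrank F ↥(x ⊓ y) + i)
    (hw : SlashCovers y (w ⊓ x) w) (hx : SlashCovers y (w ⊓ x) x) :
    (matF0 y * matFm y) w x = ((q : ℂ) - 1) * gaussC q i := by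
  have hq1 : 1 < q := hq ▸ Finite.one_lt_card
  simp only [Matrix.mul_apply, matF0, matFm, Matrix.of_apply]
  rw [sum_ite_mul_ite_eq_ncard, setOf_matF0_matFm_path_eq hw hx]
  obtain ⟨hW, -⟩ := finrank_sup_inf_of_slashCovers hw hx
  have hd := finrank_sup_add_finrank_inf_eq w x
  have hd1 := hw.1.2
  have hd2 := hx.1.2
  have hd3 := hw.2
  have hd4 := hx.2
  have hYw : ¬ (w ⊔ x) ⊓ y ≤ w := fun h => by
    have := finrank_mono (le_inf h inf_le_right : (w ⊔ x) ⊓ y ≤ w ⊓ y)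
    omega
  have hmem : w ∈ hyperplanesBetween (w ⊓ y) (w ⊔ x) \
      hyperplanesBetween ((w ⊔ x) ⊓ y) (w ⊔ x) :=
    ⟨⟨inf_le_left, le_sup_left, by omega⟩, fun h => hYw h.1⟩
  have hle : w ⊓ y ≤ (w ⊔ x) ⊓ y := inf_le_inf_right y le_sup_left
  have hsub : hyperplanesBetween ((w ⊔ x) ⊓ y) (w ⊔ x) ⊆ hyperplanesBetween (w ⊓ y) (w ⊔ x) :=
    fun z hz => ⟨hle.trans hz.1, hz.2⟩
  have h := Set.ncard_sdiff_add_ncard_of_subset hsub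
  rw [ncard_hyperplanesBetween inf_le_left (m := i) (by omega),
    ncard_hyperplanesBetween (inf_le_left.trans le_sup_left) (m := i + 1) (by omega),
    Finset.sum_range_succ, add_comm, Nat.add_left_cancel_iff, hq,
    ← Set.ncard_sdiff_singleton_add_one hmem] at h
  have hc := congrArg (Nat.cast : ℕ → ℂ) h
  push_cast at hc
  have hne : (q : ℂ) - 1 ≠ 0 := sub_ne_zero.2 (by exact_mod_cast hq1.ne')
  rw [gaussC, mul_div_cancel₀ _ hne, ← hc, add_sub_cancel_right]

end Edges

theorem statement15
    (q n k : ℕ) (hq : IsPrimePow q) (hkn : 2 * k < n) (hk : 3 ≤ k)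
    (F V : Type) [Field F] [Fintype F] (hcard : Fintype.card F = q)
    [AddCommGroup V] [Module F V] [FiniteDimensional F V]
    (hdim : Module.finrank F V = n)
    [Fintype (Submodule F V)]
    (x y : GrassVertex F V k)
    (i : ℕ) (hi : (Grass F V k).dist x y = i) (hi1 : 1 < i) (hi2 : i < k) :
    ∀ w ∈ A0set x y, ∀ w' ∈ Amset x y,
      (matF0 y.1 * matFm y.1) w.1 x.1 = 0 ∧
      (matFm y.1 * matF0 y.1) w.1 x.1 = 0 ∧
      (matF0 y.1 * matF0 y.1) w'.1 x.1 = 0 ∧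
      (matFm y.1 * matFm y.1) w.1 x.1 = (q : ℂ) ^ (i + 1) * gaussC q (k - i) ∧
      (matF0 y.1 * matFm y.1) w'.1 x.1 = ((q : ℂ) - 1) * gaussC q i ∧
      (matFm y.1 * matF0 y.1) w'.1 x.1 = ((q : ℂ) - 1) * gaussC q i := by
  intro w hw w' hw'
  obtain ⟨-, hw1, hw2, hw3, hw4⟩ := hw
  obtain ⟨-, hw1', hw2'⟩ := hw'
  have hq' : Nat.card F = q := by rw [Nat.card_eq_fintype_card, hcard]
  have hd := finrank_inf_add_dist x y
  have hx := x.2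
  have hw'd := w'.2
  have hA : w.1 ⊓ y.1 = x.1 ⊓ y.1 := hw3.inf_eq.symm.trans hw4.inf_eq
  have hki : k - i = finrank F ↥(x.1 ⊓ y.1) := by omega
  have hA' : finrank F ↥(w'.1 ⊓ y.1) = finrank F ↥(x.1 ⊓ y.1) := hw1'.2.trans hw2'.2.symm
  refine ⟨matF0_mul_matFm_apply_eq_zero hA, ?_,
    matF0_mul_matF0_apply_eq_zero (inf_ne_of_slashCovers hw1'), ?_,
    matF0_mul_matFm_apply hq' (by omega) hw1' hw2', ?_⟩
  · rw [matFm_mul_matF0_apply]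
    exact matF0_mul_matFm_apply_eq_zero hA.symm
  · rw [hki]
    exact matFm_mul_matFm_apply hq' (by omega) hw1 hw2 hw3 hw4
  · rw [matFm_mul_matF0_apply]
    rw [inf_comm] at hw1' hw2'
    exact matF0_mul_matFm_apply hq' (by omega) hw2' hw1'
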